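/- Let G be a vertex-weighted graph containing a 5-cycle v₁v₂v₃v₄v₅ (edges v₁v₂, v₂v₃, v₃v₄, v₄v₅, v₅v₁ on five distinct vertices) such that d(v₂)=d(v₃)=d(v₅)=2, d(v₁) ≥ 3, d(v₄) ≥ 3, w(v₁) ≥ w(v₂) ≥ w(v₃), w(v₃) ≤ w(v₄), and w(v₃) > w(v₅). Let G' be the graph obtained from G by removing v₅ and replacing the weight of vᵢ by w(vᵢ)−w(v₅) for each i ∈ {1,2,3,4}. Then α(G) = α(G') + 2·w(v₅). -/

import Mathlib

open scoped Classical

namespace MWIS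

variable {V : Type*}

/-- A finset of vertices is an independent set of `G`. -/
def IsIndepSet (G : SimpleGraph V) (s : Finset V) : Prop :=
  ∀ ⦃a⦄, a ∈ s → ∀ ⦃b⦄, b ∈ s → ¬G.Adj a b

/-- The maximum total weight of an independent set of `G` contained in `A`
(i.e. α of the induced subgraph `G[A]`, with the inherited weights). -/
noncomputable def alphaOn [Fintype V] (G : SimpleGraph V) (w : V → ℝ) (A : Finset V) : ℝ :=
  sSup {x : ℝ | ∃ s : Finset V, s ⊆ A ∧ IsIndepSet G s ∧ x = ∑ v ∈ s, w v}

/-- The maximum total weight of an independent set of `G`. -/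
noncomputable def alpha [Fintype V] (G : SimpleGraph V) (w : V → ℝ) : ℝ :=
  alphaOn G w Finset.univ

/-- The open neighborhood of a vertex, as a finset. -/
noncomputable def nbrs [Fintype V] (G : SimpleGraph V) (v : V) : Finset V :=
  Finset.univ.filter fun u => G.Adj v u

/-- The degree of a vertex. -/
noncomputable def deg [Fintype V] (G : SimpleGraph V) (v : V) : ℕ :=
  (nbrs G v).card

/-- The closed neighborhood `N[v]` of a vertex. -/
noncomputable def closedNbrs [Fintype V] [DecidableEq V] (G : SimpleGraph V) (v : V) : Finset V :=
  insert v (nbrs G v)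

/-- The open neighborhood `N(A)` of a vertex set. -/
noncomputable def openNbhd [Fintype V] [DecidableEq V] (G : SimpleGraph V) (A : Finset V) :
    Finset V :=
  (A.biUnion fun v => nbrs G v) \ A

/-- The closed neighborhood `N[A]` of a vertex set. -/
noncomputable def closedNbhd [Fintype V] [DecidableEq V] (G : SimpleGraph V) (A : Finset V) :
    Finset V :=
  A ∪ A.biUnion fun v => nbrs G v

/-- `s` is a maximum weighted independent set of `G` with weights `w`. -/
def IsMWIS [Fintype V] (G : SimpleGraph V) (w : V → ℝ) (s : Finset V) : Prop :=
  IsIndepSet G s ∧ ∀ t : Finset V, IsIndepSet G t → ∑ v ∈ t, w v ≤ ∑ v ∈ s, w v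

/-- `A` is the vertex set of a connected component of the subgraph of `G` induced on `B`:
`A` is the set of vertices reachable from some `x ∈ B` by paths staying inside `B`. -/
def IsCompOf (G : SimpleGraph V) (B A : Finset V) : Prop :=
  ∃ x ∈ B, ∀ y, y ∈ A ↔ Relation.ReflTransGen (fun a b => a ∈ B ∧ b ∈ B ∧ G.Adj a b) x y

lemma alphaOn_le [Fintype V] {G : SimpleGraph V} {w : V → ℝ} {A : Finset V} {b : ℝ}
    (h : ∀ s ⊆ A, IsIndepSet G s → ∑ v ∈ s, w v ≤ b) : alphaOn G w A ≤ b := by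
  refine csSup_le ⟨0, ∅, by simp [IsIndepSet]⟩ ?_
  rintro x ⟨s, hs, hi, rfl⟩
  exact h s hs hi

lemma sum_le_alphaOn [Fintype V] {G : SimpleGraph V} {w : V → ℝ} {A s : Finset V}
    (hs : s ⊆ A) (hi : IsIndepSet G s) : ∑ v ∈ s, w v ≤ alphaOn G w A := by
  refine le_csSup (Set.Finite.bddAbove ?_) ⟨s, hs, hi, rfl⟩
  refine (Set.finite_range fun t : Finset V => ∑ v ∈ t, w v).subset ?_
  rintro x ⟨t, -, -, rfl⟩
  exact ⟨t, rfl⟩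

lemma eq_or_eq_of_adj_of_deg_eq_two [Fintype V] {G : SimpleGraph V} {v a b x : V}
    (hd : deg G v = 2) (ha : G.Adj v a) (hb : G.Adj v b) (hab : a ≠ b) (hx : G.Adj v x) :
    x = a ∨ x = b := by
  have hsub : ({a, b} : Finset V) ⊆ nbrs G v := by
    intro y hy
    rcases Finset.mem_insert.1 hy with rfl | hy
    · simpa [nbrs] using ha
    · rw [Finset.mem_singleton.1 hy]
      simpa [nbrs] using hb
  have heq := Finset.eq_of_subset_of_card_le hsub (by
    rw [Finset.card_pair hab]
    exact hd.le)
  have hmem : x ∈ nbrs G v := by simpa [nbrs] using hx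
  simpa [← heq] using hmem

lemma IsIndepSet.mono {G : SimpleGraph V} {s t : Finset V} (hs : IsIndepSet G s) (h : t ⊆ s) :
    IsIndepSet G t :=
  fun _ ha _ hb => hs (h ha) (h hb)

lemma IsIndepSet.insert_of_not_adj [DecidableEq V] {G : SimpleGraph V} {s : Finset V} {v : V}
    (hs : IsIndepSet G s) (h : ∀ x ∈ s, ¬G.Adj v x) : IsIndepSet G (insert v s) := by
  intro a ha b hb hab
  rcases Finset.mem_insert.1 ha with rfl | has
  · rcases Finset.mem_insert.1 hb with rfl | hb
    · exact G.loopless.irrefl _ hab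
    · exact h b hb hab
  · rcases Finset.mem_insert.1 hb with rfl | hb
    · exact h a has hab.symm
    · exact hs has hb hab

/-- Adding a degree-two vertex to an independent set that avoids its two neighbors. -/
lemma IsIndepSet.insert_of_deg_eq_two [Fintype V] [DecidableEq V] {G : SimpleGraph V}
    {s : Finset V} {v a b : V} (hs : IsIndepSet G s) (hd : deg G v = 2) (ha : G.Adj v a)
    (hb : G.Adj v b) (hab : a ≠ b) (has : a ∉ s) (hbs : b ∉ s) : IsIndepSet G (insert v s) := by
  refine hs.insert_of_not_adj fun x hx hvx => ?_
  rcases eq_or_eq_of_adj_of_deg_eq_two hd ha hb hab hvx with rfl | rfl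
  · exact has hx
  · exact hbs hx

/-- Lowering the weights of four distinct vertices by `c` lowers the weight of `s` by `c` for each
of them that lies in `s`. -/
lemma sum_sub_on_four [DecidableEq V] (w : V → ℝ) (c : ℝ) {v₁ v₂ v₃ v₄ : V}
    (h12 : v₁ ≠ v₂) (h13 : v₁ ≠ v₃) (h14 : v₁ ≠ v₄) (h23 : v₂ ≠ v₃) (h24 : v₂ ≠ v₄)
    (h34 : v₃ ≠ v₄) (s : Finset V) :
    ∑ x ∈ s, (if x ∈ ({v₁, v₂, v₃, v₄} : Finset V) then w x - c else w x) =
      ∑ x ∈ s, w x - ((if v₁ ∈ s then c else 0) + (if v₂ ∈ s then c else 0) +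
        (if v₃ ∈ s then c else 0) + (if v₄ ∈ s then c else 0)) := by
  have hpt : ∀ x, (if x ∈ ({v₁, v₂, v₃, v₄} : Finset V) then w x - c else w x) =
      w x - ((if x = v₁ then c else 0) + (if x = v₂ then c else 0) +
        (if x = v₃ then c else 0) + (if x = v₄ then c else 0)) := by
    intro x
    simp only [Finset.mem_insert, Finset.mem_singleton]
    grind
  simp only [hpt, Finset.sum_sub_distrib, Finset.sum_add_distrib, Finset.sum_ite_eq']

/-- for a 5-cycle `v₁v₂v₃v₄v₅` with `d(v₂) = d(v₃) = d(v₅) = 2`,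
`d(v₁), d(v₄) ≥ 3`, `w(v₁) ≥ w(v₂) ≥ w(v₃) ≤ w(v₄)` and `w(v₃) > w(v₅)`:
remove `v₅` and subtract `w(v₅)` from the weights of `v₁, v₂, v₃, v₄`.
Then `α(G) = α(G') + 2·w(v₅)`. -/
theorem stmt9 [Fintype V] [DecidableEq V] (G : SimpleGraph V) (w : V → ℝ)
    (hw : ∀ x, 0 < w x) (v₁ v₂ v₃ v₄ v₅ : V)
    (hdist : List.Pairwise (· ≠ ·) [v₁, v₂, v₃, v₄, v₅])
    (e12 : G.Adj v₁ v₂) (e23 : G.Adj v₂ v₃) (e34 : G.Adj v₃ v₄) (e45 : G.Adj v₄ v₅)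
    (e51 : G.Adj v₅ v₁)
    (hd2 : deg G v₂ = 2) (hd3 : deg G v₃ = 2) (hd5 : deg G v₅ = 2)
    (hd1 : 3 ≤ deg G v₁) (hd4 : 3 ≤ deg G v₄)
    (hw12 : w v₂ ≤ w v₁) (hw23 : w v₃ ≤ w v₂) (hw34 : w v₃ ≤ w v₄)
    (hw53 : w v₅ < w v₃) :
    alpha G w =
      alphaOn G (fun x => if x ∈ ({v₁, v₂, v₃, v₄} : Finset V) then w x - w v₅ else w x)
        (Finset.univ \ {v₅}) + 2 * w v₅ := by
  simp only [List.pairwise_cons, List.mem_cons, List.not_mem_nil, or_false, forall_eq_or_imp,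
    forall_eq] at hdist
  obtain ⟨⟨h12, h13, h14, h15⟩, ⟨h23, h24, h25⟩, ⟨h34, h35⟩, h45, -⟩ := hdist
  have hc := hw v₅
  have hsum := sum_sub_on_four w (w v₅) h12 h13 h14 h23 h24 h34
  apply le_antisymm
  · have hβ : ∀ t, IsIndepSet G t → v₅ ∉ t → _ := fun t ht h5 =>
      (hsum t).symm.trans_le (sum_le_alphaOn (A := Finset.univ \ {v₅})
        (fun x hx => by simpa using ne_of_mem_of_not_mem hx h5) ht)
    generalize alphaOn G _ (Finset.univ \ {v₅}) = β at hβ ⊢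
    refine alphaOn_le fun s _ hs => ?_
    have n12 : v₁ ∈ s → v₂ ∉ s := fun h h' => hs h h' e12
    have n23 : v₂ ∈ s → v₃ ∉ s := fun h h' => hs h h' e23
    have n34 : v₃ ∈ s → v₄ ∉ s := fun h h' => hs h h' e34
    by_cases m5 : v₅ ∈ s
    · have m1 : v₁ ∉ s := fun h => hs m5 h e51
      have m4 : v₄ ∉ s := fun h => hs h m5 e45
      have herase := Finset.add_sum_erase s w m5
      have hi := hs.mono (Finset.erase_subset v₅ s)
      by_cases m : v₂ ∈ s ∨ v₃ ∈ s
      · have hle := hβ _ hi (Finset.notMem_erase v₅ s)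
        simp only [Finset.mem_erase] at hle
        grind
      · push Not at m
        have hle := hβ _ (hi.insert_of_deg_eq_two hd2 e12.symm e23 h13
          (by simp [m1]) (by simp [m.2])) (by simp [h25.symm])
        rw [Finset.sum_insert (by simp [m.1])] at hle
        simp only [Finset.mem_erase, Finset.mem_insert] at hle
        grind
    · have hle := hβ s hs m5
      grind
  · rw [← le_sub_iff_add_le]
    refine alphaOn_le fun s hsub hs => ?_
    rw [hsum, le_sub_iff_add_le]
    have m5 : v₅ ∉ s := fun h => by simpa using hsub h
    have n12 : v₁ ∈ s → v₂ ∉ s := fun h h' => hs h h' e12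
    have n23 : v₂ ∈ s → v₃ ∉ s := fun h h' => hs h h' e23
    have n34 : v₃ ∈ s → v₄ ∉ s := fun h h' => hs h h' e34
    have hα : ∀ t, IsIndepSet G t → ∑ x ∈ t, w x ≤ alpha G w := fun t ht =>
      sum_le_alphaOn (Finset.subset_univ t) ht
    have h0 := hα s hs
    by_cases m1 : v₁ ∈ s
    · have m2 := n12 m1
      by_cases m : v₃ ∈ s ∨ v₄ ∈ s
      · grind
      · push Not at m
        have h3 := hα _ (hs.insert_of_deg_eq_two hd3 e23.symm e34 h24 m2 m.2)
        rw [Finset.sum_insert m.1] at h3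
        simp only [m1, m2, m.1, m.2, if_true, if_false]
        linarith
    by_cases m4 : v₄ ∈ s
    · have m3 : v₃ ∉ s := fun h => n34 h m4
      by_cases m2 : v₂ ∈ s
      · simp only [m1, m2, m3, m4, if_true, if_false]
        linarith
      · have h2 := hα _ (hs.insert_of_deg_eq_two hd2 e12.symm e23 h13 m1 m3)
        rw [Finset.sum_insert m2] at h2
        simp only [m1, m2, m3, m4, if_true, if_false]
        linarith
    have hi5 := hs.insert_of_deg_eq_two hd5 e51 e45.symm h14 m1 m4
    by_cases m : v₂ ∈ s ∨ v₃ ∈ s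
    · have h5 := hα _ hi5
      rw [Finset.sum_insert m5] at h5
      grind
    · push Not at m
      have h25' := hα _ (hi5.insert_of_deg_eq_two hd2 e12.symm e23 h13
        (by simp [m1, h15]) (by simp [m.2, h35]))
      rw [Finset.sum_insert (by simp [m.1, h25]), Finset.sum_insert m5] at h25'
      simp only [m1, m4, m.1, m.2, if_false]
      linarith

end MWIS
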